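/- arXiv:0909.4182 — 4 statements merged into one kernel-verified Lean document; each statement's English description precedes it below -/
import Mathlib

section
/- For any two distinct points x, y ∈ ℍ at hyperbolic distance ℓ = dist(x, y) and any η > 0, the hyperbolic area of the closed η-neighborhood {z ∈ ℍ : infDist(z, [x,y]) ≤ η} of the geodesic segment [x,y] is at least 2 · ℓ · sinh(η). -/
open MeasureTheory Set Metric UpperHalfPlane

/-- The geodesic segment between two points of the hyperbolic plane, as the set of
points where the triangle inequality is an equality. -/
def geodSeg (x y : ℍ) : Set ℍ := {z : ℍ | dist x z + dist z y = dist x y}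

/-- The hyperbolic area of a subset of the upper half-plane: the measure with density
`(Im z)⁻²` with respect to 2-dimensional Lebesgue measure. -/
noncomputable def hypArea (S : Set ℍ) : ENNReal :=
  ∫⁻ z in ((↑) '' S : Set ℂ), ENNReal.ofReal ((Complex.im z ^ 2)⁻¹)

open scoped MatrixGroups

lemma hypArea_eq_volume (S : Set ℍ) : hypArea S = volume S := by
  rw [UpperHalfPlane.volume_eq_lintegral, hypArea]
  congr 1
  ext z
  rw [ENNReal.ofReal]
  congr 1
  ext
  rw [Real.coe_toNNReal _ (by positivity)]
  simp

lemma exists_SL_re_zero (x y : ℍ) :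
    ∃ g : SL(2, ℝ), (g • x).re = 0 ∧ (g • y).re = 0 := by
  by_cases h : x.re = y.re
  · let g : SL(2, ℝ) := ⟨!![1, -x.re; 0, 1], by simp [Matrix.det_fin_two]⟩
    have key : ∀ z : ℍ, (g • z).re = z.re - x.re := by
      intro z
      rw [← coe_re, coe_specialLinearGroup_apply]
      simp [g, sub_eq_add_neg]
    exact ⟨g, by rw [key]; ring, by rw [key, h]; ring⟩
  · obtain ⟨c, hc⟩ : ∃ c : ℝ, (x.re - c) ^ 2 + x.im ^ 2 = (y.re - c) ^ 2 + y.im ^ 2 := by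
      have h' : x.re - y.re ≠ 0 := sub_ne_zero.2 h
      refine ⟨(x.re ^ 2 + x.im ^ 2 - y.re ^ 2 - y.im ^ 2) / (2 * (x.re - y.re)), ?_⟩
      field_simp
      ring
    obtain ⟨R, hR, hRx⟩ : ∃ R : ℝ, 0 < R ∧ (x.re - c) ^ 2 + x.im ^ 2 = R ^ 2 := by
      have := x.im_pos
      exact ⟨√((x.re - c) ^ 2 + x.im ^ 2), by positivity, (Real.sq_sqrt (by positivity)).symm⟩
    have hRy := hc ▸ hRx
    obtain ⟨α, hα⟩ : ∃ α : ℝ, α ^ 2 * (2 * R) = 1 := by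
      refine ⟨√((2 * R)⁻¹), ?_⟩
      rw [Real.sq_sqrt (by positivity)]
      field_simp
    let g : SL(2, ℝ) := ⟨!![α, -α * (c - R); -α, α * (c + R)], by
      rw [Matrix.det_fin_two_of]; linear_combination hα⟩
    have key : ∀ z : ℍ, (z.re - c) ^ 2 + z.im ^ 2 = R ^ 2 → (g • z).re = 0 := by
      intro z hz
      rw [← coe_re, coe_specialLinearGroup_apply]
      simp [g, Complex.div_re]
      rw [← add_div]
      apply div_eq_zero_iff.2
      left
      linear_combination (-α ^ 2) * hz
    exact ⟨g, key x hRx, key y hRy⟩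

lemma volume_nbhd_smul (g : SL(2, ℝ)) (x y : ℍ) (η : ℝ) :
    volume {z : ℍ | infDist z (geodSeg x y) ≤ η} =
      volume {z : ℍ | infDist z (geodSeg (g • x) (g • y)) ≤ η} := by
  have hseg : geodSeg (g • x) (g • y) = (fun z => g • z) '' geodSeg x y := by
    ext z
    constructor
    · intro hz
      refine ⟨g⁻¹ • z, ?_, by simp⟩
      have h1 : dist x (g⁻¹ • z) = dist (g • x) z := by
        rw [← dist_smul g x, smul_inv_smul]
      have h2 : dist (g⁻¹ • z) y = dist z (g • y) := by
        rw [← dist_smul g _ y, smul_inv_smul]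
      simp only [geodSeg, mem_ofPred_eq] at hz ⊢
      rw [h1, h2, hz, dist_smul]
    · rintro ⟨w, hw, rfl⟩
      simpa only [geodSeg, mem_ofPred_eq, dist_smul] using hw
  have h := measure_preimage_smul (volume : Measure ℍ) (g : GL (Fin 2) ℝ)
    {z : ℍ | infDist z (geodSeg (g • x) (g • y)) ≤ η}
  rw [← h, hseg]
  congr 1
  ext z
  have := infDist_image (x := z) (t := geodSeg x y) (isometry_smul ℍ g)
  show _ ↔ infDist (g • z) _ ≤ η
  rw [mem_ofPred_eq, this]

lemma mem_nbhd {x y : ℍ} (hx : x.re = 0) (hy : y.re = 0) (hxy : x.im ≤ y.im) {η : ℝ} (hη : 0 < η)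
    (z : ℍ) (h1 : x.im ^ 2 ≤ z.re ^ 2 + z.im ^ 2) (h2 : z.re ^ 2 + z.im ^ 2 ≤ y.im ^ 2)
    (h3 : |z.re| ≤ Real.sinh η * z.im) : infDist z (geodSeg x y) ≤ η := by
  have hzi := z.im_pos
  obtain ⟨r, hr, hrz⟩ : ∃ r : ℝ, 0 < r ∧ z.re ^ 2 + z.im ^ 2 = r ^ 2 :=
    ⟨√(z.re ^ 2 + z.im ^ 2), by positivity, (Real.sq_sqrt (by positivity)).symm⟩
  rw [hrz] at h1 h2
  have h1' : x.im ≤ r := le_of_sq_le_sq h1 hr.le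
  have h2' : r ≤ y.im := le_of_sq_le_sq h2 y.im_pos.le
  let w : ℍ := ⟨⟨0, r⟩, hr⟩
  have hwre : w.re = 0 := rfl
  have hwim : w.im = r := rfl
  have hw : w ∈ geodSeg x y := by
    simp only [geodSeg, mem_ofPred_eq]
    rw [dist_of_re_eq (hx.trans hwre.symm), dist_of_re_eq (hwre.trans hy.symm),
      dist_of_re_eq (hx.trans hy.symm), hwim]
    have l1 := Real.log_le_log x.im_pos h1'
    have l2 := Real.log_le_log hr h2'
    rw [Real.dist_eq, Real.dist_eq, Real.dist_eq, abs_of_nonpos (by linarith),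
      abs_of_nonpos (by linarith), abs_of_nonpos (by linarith)]
    ring
  refine (infDist_le_dist_of_mem hw).trans ?_
  have hc : Real.cosh (dist z w) = r / z.im := by
    rw [cosh_dist', hwre, hwim]
    field_simp
    linear_combination hrz
  have : Real.cosh (dist z w) ≤ Real.cosh η := by
    rw [hc, div_le_iff₀ hzi]
    have hcp := Real.cosh_pos η
    apply le_of_sq_le_sq _ (by positivity)
    rw [← hrz, mul_pow, Real.cosh_sq]
    have := sq_le_sq' (by linarith [neg_abs_le z.re, abs_nonneg z.re]) h3
    rw [sq_abs] at this
    nlinarith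
  rwa [Real.cosh_le_cosh, abs_of_nonneg dist_nonneg, abs_of_pos hη] at this

lemma lintegral_scale (f : ℝ → ENNReal) (hf : Measurable f) {y : ℝ} (hy : 0 < y) :
    ∫⁻ x, f x = ∫⁻ t, ENNReal.ofReal y * f (y * t) := by
  conv_lhs => rw [← Real.smul_map_volume_mul_left hy.ne']
  rw [lintegral_smul_measure, lintegral_map hf (by fun_prop), abs_of_pos hy,
    lintegral_const_mul _ (by fun_prop)]
  rfl

lemma inner_lintegral {a b : ℝ} (ha : 0 < a) (hab : a ≤ b) (t : ℝ) :
    ENNReal.ofReal (Real.log (b / a)) ≤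
    ∫⁻ y, {y : ℝ | 0 < y ∧ a ^ 2 ≤ (y * t) ^ 2 + y ^ 2 ∧ (y * t) ^ 2 + y ^ 2 ≤ b ^ 2}.indicator
      (fun y => ENNReal.ofReal y⁻¹) y := by
  have hb := ha.trans_le hab
  obtain ⟨u, hu, hut⟩ : ∃ u : ℝ, 0 < u ∧ u ^ 2 = 1 + t ^ 2 :=
    ⟨√(1 + t ^ 2), by positivity, Real.sq_sqrt (by positivity)⟩
  have hle : a / u ≤ b / u := by gcongr
  have hau : 0 < a / u := by positivity
  have h1 : Real.log (b / a) = ∫ y in a / u..b / u, y⁻¹ := by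
    rw [integral_inv_of_pos (by positivity) (by positivity)]
    congr 1
    field_simp
  rw [h1, intervalIntegral.integral_of_le hle, ofReal_integral_eq_lintegral_ofReal,
    ← lintegral_indicator measurableSet_Ioc]
  · apply lintegral_mono
    apply indicator_le_indicator_of_subset
    · rintro y ⟨hy1, hy2⟩
      have hy : 0 < y := hau.trans hy1
      have e : (y * t) ^ 2 + y ^ 2 = (y * u) ^ 2 := by rw [mul_pow y u, hut]; ring
      refine ⟨hy, ?_, ?_⟩
      · rw [e]
        have := (div_lt_iff₀ hu).1 hy1
        gcongr
      · rw [e]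
        have := (le_div_iff₀ hu).1 hy2
        gcongr
    · intro _; exact bot_le
  · have : IntervalIntegrable (fun y : ℝ => y⁻¹) volume (a / u) (b / u) := by
      apply intervalIntegral.intervalIntegrable_inv
      · intro y hy
        rw [uIcc_of_le hle] at hy
        exact (hau.trans_le hy.1).ne'
      · exact continuousOn_id
    exact (intervalIntegrable_iff_integrableOn_Ioc_of_le hle).1 this
  · filter_upwards [ae_restrict_mem measurableSet_Ioc] with y hy
    exact inv_nonneg.2 (hau.trans hy.1).le

lemma area_region {a b s : ℝ} (ha : 0 < a) (hab : a ≤ b) (hs : 0 < s) :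
    ENNReal.ofReal (2 * Real.log (b / a) * s) ≤
    ∫⁻ z in {z : ℂ | 0 < z.im ∧ (a ^ 2 ≤ z.re ^ 2 + z.im ^ 2 ∧ z.re ^ 2 + z.im ^ 2 ≤ b ^ 2) ∧
      |z.re| ≤ s * z.im}, ENNReal.ofReal ((z.im ^ 2)⁻¹) := by
  have hm : MeasurableSet {z : ℂ | 0 < z.im ∧ (a ^ 2 ≤ z.re ^ 2 + z.im ^ 2 ∧
      z.re ^ 2 + z.im ^ 2 ≤ b ^ 2) ∧ |z.re| ≤ s * z.im} := by
    measurability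
  have hm2 : MeasurableSet {p : ℝ × ℝ | 0 < p.2 ∧ (a ^ 2 ≤ p.1 ^ 2 + p.2 ^ 2 ∧
      p.1 ^ 2 + p.2 ^ 2 ≤ b ^ 2) ∧ |p.1| ≤ s * p.2} := by
    measurability
  set F : ℝ × ℝ → ENNReal := {p : ℝ × ℝ | 0 < p.2 ∧ (a ^ 2 ≤ p.1 ^ 2 + p.2 ^ 2 ∧
      p.1 ^ 2 + p.2 ^ 2 ≤ b ^ 2) ∧ |p.1| ≤ s * p.2}.indicator
      (fun p => ENNReal.ofReal ((p.2 ^ 2)⁻¹)) with hF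
  have hFm : Measurable F := Measurable.indicator (by fun_prop) hm2
  rw [← lintegral_indicator hm]
  have e1 : ∀ z : ℂ, {z : ℂ | 0 < z.im ∧ (a ^ 2 ≤ z.re ^ 2 + z.im ^ 2 ∧
      z.re ^ 2 + z.im ^ 2 ≤ b ^ 2) ∧ |z.re| ≤ s * z.im}.indicator
      (fun z => ENNReal.ofReal ((z.im ^ 2)⁻¹)) z = F (Complex.measurableEquivRealProd z) := by
    intro z
    rfl
  simp_rw [e1]
  rw [Complex.volume_preserving_equiv_real_prod.lintegral_comp hFm, Measure.volume_eq_prod,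
    lintegral_prod_symm _ hFm.aemeasurable]
  set G : ℝ → ℝ → ENNReal := fun y t => (Icc (-s) s).indicator (fun t =>
    {y : ℝ | 0 < y ∧ a ^ 2 ≤ (y * t) ^ 2 + y ^ 2 ∧ (y * t) ^ 2 + y ^ 2 ≤ b ^ 2}.indicator
      (fun y => ENNReal.ofReal y⁻¹) y) t with hG
  have e2 : ∀ y t : ℝ, 0 < y → ENNReal.ofReal y * F (y * t, y) = G y t := by
    intro y t hy
    have h3 : |y * t| ≤ s * y ↔ t ∈ Icc (-s) s := by
      rw [abs_mul, abs_of_pos hy, mul_comm, mul_le_mul_iff_left₀ hy, abs_le, mem_Icc]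
    simp only [hF, hG, indicator_apply, mem_ofPred_eq, h3, hy, true_and]
    by_cases ht : t ∈ Icc (-s) s
    · simp only [ht, and_true, if_true]
      split_ifs
      · rw [← ENNReal.ofReal_mul hy.le]
        congr 1
        field_simp
      · simp
    · simp [ht]
  have e3 : ∀ y : ℝ, ∫⁻ x, F (x, y) = ∫⁻ t, G y t := by
    intro y
    by_cases hy : 0 < y
    · rw [lintegral_scale _ (by fun_prop) hy]
      exact lintegral_congr fun t => e2 y t hy
    · have : ∀ t, F (t, y) = G y t := by
        intro t
        simp [hF, hG, indicator_apply, hy]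
      simp_rw [this]
  simp_rw [e3]
  have hGm : Measurable (Function.uncurry G) := by
    have : Function.uncurry G = {p : ℝ × ℝ | p.2 ∈ Icc (-s) s ∧ 0 < p.1 ∧
        a ^ 2 ≤ (p.1 * p.2) ^ 2 + p.1 ^ 2 ∧ (p.1 * p.2) ^ 2 + p.1 ^ 2 ≤ b ^ 2}.indicator
        (fun p => ENNReal.ofReal p.1⁻¹) := by
      ext ⟨y, t⟩
      simp only [Function.uncurry, hG, indicator_apply, mem_ofPred_eq, ite_and]
    rw [this]
    refine Measurable.indicator (by fun_prop) ?_
    simp only [mem_Icc]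
    measurability
  rw [lintegral_lintegral_swap hGm.aemeasurable]
  calc ENNReal.ofReal (2 * Real.log (b / a) * s)
      = ∫⁻ t in Icc (-s) s, ENNReal.ofReal (Real.log (b / a)) := by
        rw [setLIntegral_const, Real.volume_Icc, ← ENNReal.ofReal_mul]
        · congr 1; ring
        · exact Real.log_nonneg ((one_le_div ha).2 hab)
    _ = ∫⁻ t, (Icc (-s) s).indicator (fun _ => ENNReal.ofReal (Real.log (b / a))) t := by
        rw [lintegral_indicator measurableSet_Icc]
    _ ≤ _ := by
        apply lintegral_mono
        intro t
        by_cases ht : t ∈ Icc (-s) s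
        · simp only [hG, indicator_of_mem ht]
          exact inner_lintegral ha hab t
        · simp [ht]

lemma main_aux {x y : ℍ} (hx : x.re = 0) (hy : y.re = 0) (hxy : x.im ≤ y.im) {η : ℝ}
    (hη : 0 < η) : ENNReal.ofReal (2 * dist x y * Real.sinh η) ≤
      hypArea {z : ℍ | infDist z (geodSeg x y) ≤ η} := by
  have hd : dist x y = Real.log (y.im / x.im) := by
    rw [dist_of_re_eq (hx.trans hy.symm), Real.dist_eq, abs_sub_comm, abs_of_nonneg,
      Real.log_div y.im_ne_zero x.im_ne_zero]
    linarith [Real.log_le_log x.im_pos hxy]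
  rw [hd]
  refine (area_region x.im_pos hxy (Real.sinh_pos_iff.2 hη)).trans ?_
  apply lintegral_mono_set
  rintro z ⟨hz, ⟨h1, h2⟩, h3⟩
  exact ⟨⟨z, hz⟩, mem_nbhd hx hy hxy hη _ h1 h2 h3, rfl⟩

lemma geodSeg_comm (x y : ℍ) : geodSeg x y = geodSeg y x := by
  ext z
  simp only [geodSeg, mem_ofPred_eq, dist_comm x, dist_comm z y, add_comm]

/-- The hyperbolic area of the closed `η`-neighbourhood of a geodesic segment of length
`ℓ = dist x y` is at least `2 ℓ sinh η`. -/
theorem hypArea_nbhd_geodSeg_ge (x y : ℍ) (hxy : x ≠ y) (η : ℝ) (hη : 0 < η) :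
    ENNReal.ofReal (2 * dist x y * Real.sinh η) ≤
      hypArea {z : ℍ | infDist z (geodSeg x y) ≤ η} := by
  obtain ⟨g, hx, hy⟩ := exists_SL_re_zero x y
  rw [hypArea_eq_volume, volume_nbhd_smul g, ← hypArea_eq_volume, ← dist_smul g x y]
  rcases le_total (g • x).im (g • y).im with h | h
  · exact main_aux hx hy h hη
  · rw [dist_comm, geodSeg_comm]
    exact main_aux hy hx h hη
end

section
/- Let A, B, C be three pairwise distinct points of ℍ, and let T be the smallest closed metrically convex subset of ℍ containing {A, B, C} (the geodesic triangle with vertices A, B, C). Then the hyperbolic area of T is strictly less than each of the three side lengths dist(A,B), dist(B,C), dist(C,A). -/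
open MeasureTheory Set Metric UpperHalfPlane

/-- A subset of the hyperbolic plane is metrically convex if it contains the geodesic
segment between any two of its points. -/
def MConvex (K : Set ℍ) : Prop := ∀ x ∈ K, ∀ y ∈ K, geodSeg x y ⊆ K

open scoped MatrixGroups

lemma null_vec (P Q R p3 q3 r3 : ℝ) (p3pos : 0 < p3) (r3pos : 0 < r3)
    (n3 : p3 * r3 - q3 ^ 2 = 1) (w1 : (P * r3 + R * p3) / 2 - Q * q3 = 0)
    (w2 : P * R - Q ^ 2 = 0) : P = 0 ∧ Q = 0 ∧ R = 0 := by
  have w3 : ((P * r3 - R * p3) / 2) ^ 2 + Q ^ 2 = 0 := by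
    linear_combination ((P * r3 + R * p3) / 2 + Q * q3) * w1 - r3 * p3 * w2 - Q ^ 2 * n3
  have hQ0 : Q = 0 := by
    have : Q ^ 2 = 0 := le_antisymm (by linarith [sq_nonneg ((P * r3 - R * p3) / 2)]) (sq_nonneg _)
    exact pow_eq_zero_iff two_ne_zero |>.1 this
  subst hQ0
  have hPR : P * r3 + R * p3 = 0 := by linarith
  have hPR' : P * r3 - R * p3 = 0 := by
    have : ((P * r3 - R * p3) / 2) ^ 2 = 0 := by linarith
    have := pow_eq_zero_iff (two_ne_zero) |>.1 this
    linarith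
  have hP0 : P = 0 := by
    have : P * r3 = 0 := by linarith
    exact (mul_eq_zero.1 this).resolve_right r3pos.ne'
  have hR0 : R = 0 := by
    have : R * p3 = 0 := by linarith
    exact (mul_eq_zero.1 this).resolve_right p3pos.ne'
  exact ⟨hP0, rfl, hR0⟩

set_option maxHeartbeats 1000000 in
lemma geod_formula (α β γ : ℝ) (x y z : ℍ) (hz : z ∈ geodSeg x y) :
    Real.sinh (dist x y) * ((α * (z.re ^ 2 + z.im ^ 2) + β * z.re + γ) / z.im)
    = Real.sinh (dist z y) * ((α * (x.re ^ 2 + x.im ^ 2) + β * x.re + γ) / x.im)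
    + Real.sinh (dist x z) * ((α * (y.re ^ 2 + y.im ^ 2) + β * y.re + γ) / y.im) := by
  have hL : dist x z + dist z y = dist x y := hz
  have h1 := UpperHalfPlane.cosh_dist' x z
  have h2 := UpperHalfPlane.cosh_dist' z y
  have h3 := UpperHalfPlane.cosh_dist' x y
  rw [← hL] at h3 ⊢
  rw [Real.cosh_add] at h3
  rw [Real.sinh_add]
  have e1 := Real.cosh_sq (dist x z)
  have e2 := Real.cosh_sq (dist z y)
  generalize Real.cosh (dist x z) = cs at *
  generalize Real.cosh (dist z y) = ct at *
  generalize Real.sinh (dist x z) = ss at *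
  generalize Real.sinh (dist z y) = st at *
  have hx := x.im_pos
  have hy := y.im_pos
  have hzp := z.im_pos
  generalize x.re = a at *
  generalize y.re = b at *
  generalize z.re = c at *
  generalize x.im = a' at *
  generalize y.im = b' at *
  generalize z.im = c' at *
  clear hz hL
  obtain ⟨p1, hp1⟩ : ∃ p, p = 1 / a' := ⟨_, rfl⟩
  obtain ⟨p2, hp2⟩ : ∃ p, p = 1 / b' := ⟨_, rfl⟩
  obtain ⟨p3, hp3⟩ : ∃ p, p = 1 / c' := ⟨_, rfl⟩
  obtain ⟨q1, hq1⟩ : ∃ p, p = a / a' := ⟨_, rfl⟩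
  obtain ⟨q2, hq2⟩ : ∃ p, p = b / b' := ⟨_, rfl⟩
  obtain ⟨q3, hq3⟩ : ∃ p, p = c / c' := ⟨_, rfl⟩
  obtain ⟨r1, hr1⟩ : ∃ p, p = (a ^ 2 + a' ^ 2) / a' := ⟨_, rfl⟩
  obtain ⟨r2, hr2⟩ : ∃ p, p = (b ^ 2 + b' ^ 2) / b' := ⟨_, rfl⟩
  obtain ⟨r3, hr3⟩ : ∃ p, p = (c ^ 2 + c' ^ 2) / c' := ⟨_, rfl⟩
  have n1 : p1 * r1 - q1 ^ 2 = 1 := by rw [hp1, hq1, hr1]; field_simp; ring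
  have n2 : p2 * r2 - q2 ^ 2 = 1 := by rw [hp2, hq2, hr2]; field_simp; ring
  have n3 : p3 * r3 - q3 ^ 2 = 1 := by rw [hp3, hq3, hr3]; field_simp; ring
  have h1' : (p1 * r3 + p3 * r1) / 2 - q1 * q3 = cs := by
    rw [h1, hp1, hq1, hr1, hp3, hq3, hr3]; field_simp; ring
  have h2' : (p3 * r2 + p2 * r3) / 2 - q2 * q3 = ct := by
    rw [h2, hp2, hq2, hr2, hp3, hq3, hr3]; field_simp; ring
  have h3' : (p1 * r2 + p2 * r1) / 2 - q1 * q2 = cs * ct + ss * st := by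
    rw [h3, hp2, hq2, hr2, hp1, hq1, hr1]; field_simp; ring
  have p3pos : 0 < p3 := by rw [hp3]; positivity
  have r3pos : 0 < r3 := by rw [hr3]; positivity
  obtain ⟨S, hS⟩ : ∃ S, S = ss * ct + cs * st := ⟨_, rfl⟩
  obtain ⟨P, hP⟩ : ∃ P, P = S * p3 - st * p1 - ss * p2 := ⟨_, rfl⟩
  obtain ⟨Q, hQ⟩ : ∃ P, P = S * q3 - st * q1 - ss * q2 := ⟨_, rfl⟩
  obtain ⟨R, hR⟩ : ∃ P, P = S * r3 - st * r1 - ss * r2 := ⟨_, rfl⟩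
  have w1 : (P * r3 + R * p3) / 2 - Q * q3 = 0 := by
    have : (P * r3 + R * p3) / 2 - Q * q3 = S * (p3 * r3 - q3 ^ 2)
      - st * ((p1 * r3 + p3 * r1) / 2 - q1 * q3) - ss * ((p3 * r2 + p2 * r3) / 2 - q2 * q3) := by
      rw [hP, hQ, hR]; ring
    rw [this, n3, h1', h2', hS]; ring
  have w2 : P * R - Q ^ 2 = 0 := by
    have : P * R - Q ^ 2 = S ^ 2 * (p3 * r3 - q3 ^ 2) + st ^ 2 * (p1 * r1 - q1 ^ 2)
      + ss ^ 2 * (p2 * r2 - q2 ^ 2)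
      - 2 * S * st * ((p1 * r3 + p3 * r1) / 2 - q1 * q3)
      - 2 * S * ss * ((p3 * r2 + p2 * r3) / 2 - q2 * q3)
      + 2 * ss * st * ((p1 * r2 + p2 * r1) / 2 - q1 * q2) := by
      rw [hP, hQ, hR]; ring
    rw [this, n1, n2, n3, h1', h2', h3', hS]
    linear_combination (-st ^ 2) * e1 - ss ^ 2 * e2
  obtain ⟨hP0, hQ0, hR0⟩ := null_vec P Q R p3 q3 r3 p3pos r3pos n3 w1 w2
  have f1 : (α * (a ^ 2 + a' ^ 2) + β * a + γ) / a' = α * r1 + β * q1 + γ * p1 := by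
    rw [hp1, hq1, hr1]; field_simp
  have f2 : (α * (b ^ 2 + b' ^ 2) + β * b + γ) / b' = α * r2 + β * q2 + γ * p2 := by
    rw [hp2, hq2, hr2]; field_simp
  have f3 : (α * (c ^ 2 + c' ^ 2) + β * c + γ) / c' = α * r3 + β * q3 + γ * p3 := by
    rw [hp3, hq3, hr3]; field_simp
  rw [f1, f2, f3, ← hS]
  linear_combination α * (hR0 - hR) + β * (hQ0 - hQ) + γ * (hP0 - hP)

lemma mconvex_half (α β γ : ℝ) :
    MConvex {z : ℍ | 0 ≤ α * (z.re ^ 2 + z.im ^ 2) + β * z.re + γ} := by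
  intro x hx y hy z hz
  have hL : dist x z + dist z y = dist x y := hz
  rcases eq_or_ne x y with rfl | hne
  · rw [dist_self] at hL
    have : dist x z = 0 := by
      linarith [dist_nonneg (x := x) (y := z), dist_nonneg (x := z) (y := x)]
    rw [← dist_eq_zero.1 this]; exact hx
  · have h := geod_formula α β γ x y z hz
    have hs : 0 < Real.sinh (dist x y) := Real.sinh_pos_iff.2 (dist_pos.2 hne)
    have h1 : 0 ≤ Real.sinh (dist z y) := Real.sinh_nonneg_iff.2 dist_nonneg
    have h2 : 0 ≤ Real.sinh (dist x z) := Real.sinh_nonneg_iff.2 dist_nonneg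
    have h3 := div_nonneg (show 0 ≤ α * (x.re ^ 2 + x.im ^ 2) + β * x.re + γ from hx) x.im_pos.le
    have h4 := div_nonneg (show 0 ≤ α * (y.re ^ 2 + y.im ^ 2) + β * y.re + γ from hy) y.im_pos.le
    have h5 : 0 ≤ Real.sinh (dist x y) * ((α * (z.re ^ 2 + z.im ^ 2) + β * z.re + γ) / z.im) := by
      rw [h]; positivity
    have h6 := nonneg_of_mul_nonneg_right h5 hs
    have h7 : 0 ≤ α * (z.re ^ 2 + z.im ^ 2) + β * z.re + γ := by
      have := mul_nonneg h6 z.im_pos.le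
      rwa [div_mul_cancel₀ _ z.im_pos.ne'] at this
    exact h7

lemma closed_half (α β γ : ℝ) :
    IsClosed {z : ℍ | 0 ≤ α * (z.re ^ 2 + z.im ^ 2) + β * z.re + γ} := by
  have h1 := UpperHalfPlane.continuous_re
  have h2 := UpperHalfPlane.continuous_im
  exact isClosed_le (by fun_prop) (by fun_prop)

lemma MConvex.inter {K L : Set ℍ} (hK : MConvex K) (hL : MConvex L) : MConvex (K ∩ L) :=
  fun x hx y hy z hz => ⟨hK x hx.1 y hy.1 hz, hL x hx.2 y hy.2 hz⟩

def GoodTri (A B C : ℍ) : Prop :=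
  ∃ K : Set ℍ, IsClosed K ∧ MConvex K ∧ A ∈ K ∧ B ∈ K ∧ C ∈ K ∧
    hypArea K < ENNReal.ofReal (dist A B)

lemma GoodTri.of_smul (g : SL(2, ℝ)) {A B C : ℍ} (h : GoodTri (g • A) (g • B) (g • C)) :
    GoodTri A B C := by
  obtain ⟨K, h1, h2, hA, hB, hC, h3⟩ := h
  have hc : Continuous (fun z : ℍ => g • z) := (isometry_smul ℍ g).continuous
  refine ⟨(fun z : ℍ => g • z) ⁻¹' K, h1.preimage hc, ?_, hA, hB, hC, ?_⟩
  · intro x hx y hy z hz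
    refine h2 _ hx _ hy ?_
    have hL : dist x z + dist z y = dist x y := hz
    change dist (g • x) (g • z) + dist (g • z) (g • y) = dist (g • x) (g • y)
    simpa only [dist_smul] using hL
  · rw [dist_smul, hypArea_eq_volume] at h3
    rw [hypArea_eq_volume]
    have := measure_preimage_smul (μ := (volume : Measure ℍ)) (g : GL (Fin 2) ℝ) K
    rw [← this] at h3
    exact h3

/-- The map `z ↦ -1/(z-ξ)`. -/
noncomputable def invAt (ξ : ℝ) : SL(2, ℝ) := ⟨!![0, -1; 1, -ξ], by simp [Matrix.det_fin_two]⟩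

lemma invAt_coe (ξ : ℝ) (z : ℍ) : ((invAt ξ • z : ℍ) : ℂ) = -1 / ((z : ℂ) - ξ) := by
  rw [UpperHalfPlane.coe_specialLinearGroup_apply]
  simp [invAt, sub_eq_add_neg]

lemma invAt_re (ξ : ℝ) (z : ℍ) :
    (invAt ξ • z).re = -(z.re - ξ) / ((z.re - ξ) ^ 2 + z.im ^ 2) := by
  rw [← UpperHalfPlane.coe_re, invAt_coe, Complex.div_re]
  simp [Complex.normSq_apply]
  ring

lemma invAt_im (ξ : ℝ) (z : ℍ) :
    (invAt ξ • z).im = z.im / ((z.re - ξ) ^ 2 + z.im ^ 2) := by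
  rw [← UpperHalfPlane.coe_im, invAt_coe, Complex.div_im]
  simp [Complex.normSq_apply]
  ring

lemma exists_vertical (A C : ℍ) (h : A ≠ C) :
    ∃ g : SL(2, ℝ), (g • A).re = (g • C).re ∧ (g • A).im < (g • C).im := by
  have step : ∀ A C : ℍ, A ≠ C → A.re = C.re →
    ∃ g : SL(2, ℝ), (g • A).re = (g • C).re ∧ (g • A).im < (g • C).im := by
    intro A C h hre
    rcases lt_trichotomy A.im C.im with hlt | heq | hgt
    · exact ⟨1, by simpa using hre, by simpa using hlt⟩
    · exact absurd (UpperHalfPlane.ext_re_im hre heq) h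
    · refine ⟨invAt A.re, ?_, ?_⟩
      · rw [invAt_re, invAt_re, ← hre]; simp
      · rw [invAt_im, invAt_im, ← hre]
        have := A.im_pos
        have := C.im_pos
        simp only [sub_self]
        rw [div_lt_div_iff₀ (by positivity) (by positivity)]
        nlinarith [mul_pos A.im_pos C.im_pos]
  by_cases hre : A.re = C.re
  · exact step A C h hre
  · have hd : C.re - A.re ≠ 0 := sub_ne_zero.2 (Ne.symm hre)
    obtain ⟨c, hc⟩ : ∃ c : ℝ, (A.re - c) ^ 2 + A.im ^ 2 = (C.re - c) ^ 2 + C.im ^ 2 := by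
      refine ⟨(C.re ^ 2 + C.im ^ 2 - A.re ^ 2 - A.im ^ 2) / (2 * (C.re - A.re)), ?_⟩
      field_simp
      ring
    obtain ⟨r, hr0, hr⟩ : ∃ r : ℝ, 0 < r ∧ r ^ 2 = (A.re - c) ^ 2 + A.im ^ 2 := by
      have := A.im_pos
      exact ⟨√((A.re - c) ^ 2 + A.im ^ 2), by positivity, Real.sq_sqrt (by positivity)⟩
    have key : ∀ z : ℍ, (z.re - c) ^ 2 + z.im ^ 2 = r ^ 2 →
        (invAt (c + r) • z).re = 1 / (2 * r) := by
      intro z hz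
      rw [invAt_re]
      have := z.im_pos
      have : 0 < (z.re - (c + r)) ^ 2 + z.im ^ 2 := by positivity
      rw [div_eq_div_iff this.ne' (by positivity)]
      linear_combination -hz
    obtain ⟨g, h1, h2⟩ := step (invAt (c + r) • A) (invAt (c + r) • C)
      (fun hh => h (smul_left_cancel _ hh))
      (by rw [key A hr.symm, key C (by rw [hr, hc])])
    exact ⟨g * invAt (c + r), by simpa only [mul_smul] using h1, by simpa only [mul_smul] using h2⟩

lemma cosh_mul_cos_lt (u : ℝ) (h0 : 0 < u) (h1 : u < Real.pi / 2) :
    Real.cosh u * Real.cos u < 1 := by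
  have hc : 0 < Real.cos u := Real.cos_pos_of_mem_Ioo ⟨by linarith, h1⟩
  have hanti : StrictAntiOn (fun t : ℝ => Real.exp (t ^ 2 / 2) * Real.cos t) (Icc 0 u) := by
    apply strictAntiOn_of_deriv_neg (convex_Icc _ _) (by fun_prop)
    intro t ht
    rw [interior_Icc] at ht
    have hd : HasDerivAt (fun t : ℝ => Real.exp (t ^ 2 / 2) * Real.cos t)
        (Real.exp (t ^ 2 / 2) * t * Real.cos t + Real.exp (t ^ 2 / 2) * (- Real.sin t)) t := by
      have h1 : HasDerivAt (fun t : ℝ => t ^ 2 / 2) t t := by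
        have := (hasDerivAt_pow 2 t).div_const 2
        simpa using this
      exact h1.exp.mul (Real.hasDerivAt_cos t)
    rw [hd.deriv]
    have hct : 0 < Real.cos t := Real.cos_pos_of_mem_Ioo ⟨by linarith [ht.1], by linarith [ht.2]⟩
    have := Real.lt_tan ht.1 (ht.2.trans h1)
    rw [Real.tan_eq_sin_div_cos, lt_div_iff₀ hct] at this
    nlinarith [Real.exp_pos (t ^ 2 / 2)]
  have h2 := hanti (left_mem_Icc.2 h0.le) (right_mem_Icc.2 h0.le) h0
  simp only [ne_eq, OfNat.ofNat_ne_zero, not_false_eq_true, zero_pow, zero_div, Real.exp_zero,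
    Real.cos_zero, mul_one] at h2
  exact lt_of_le_of_lt (mul_le_mul_of_nonneg_right (Real.cosh_le_exp_half_sq u) hc.le) h2

lemma angle_lt (φ ψ d : ℝ) (h1 : -(Real.pi / 2) < φ) (h2 : φ < ψ) (h3 : ψ < Real.pi / 2)
    (hd : 0 ≤ d)
    (h : Real.cosh d = (1 - Real.sin φ * Real.sin ψ) / (Real.cos φ * Real.cos ψ)) :
    ψ - φ < d := by
  have hφ : 0 < Real.cos φ := Real.cos_pos_of_mem_Ioo ⟨h1, by linarith⟩
  have hψ : 0 < Real.cos ψ := Real.cos_pos_of_mem_Ioo ⟨by linarith, h3⟩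
  obtain ⟨u, hu⟩ : ∃ u, u = (ψ - φ) / 2 := ⟨_, rfl⟩
  have hcu : 0 < Real.cos u := Real.cos_pos_of_mem_Ioo ⟨by linarith, by linarith⟩
  have hk := cosh_mul_cos_lt u (by linarith) (by linarith)
  have e1 : Real.cos ψ * Real.cos φ + Real.sin ψ * Real.sin φ = 2 * Real.cos u ^ 2 - 1 := by
    rw [← Real.cos_sub, ← Real.cos_two_mul]; congr 1; linarith
  have e2 : Real.cos ψ * Real.cos φ - Real.sin ψ * Real.sin φ ≤ 1 := by
    rw [← Real.cos_add]; exact Real.cos_le_one _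
  have e3 : Real.cosh (ψ - φ) = 2 * Real.cosh u ^ 2 - 1 := by
    have : ψ - φ = 2 * u := by linarith
    rw [this, Real.cosh_two_mul, Real.sinh_sq]; ring
  have hlt : Real.cosh (ψ - φ) < Real.cosh d := by
    rw [h, e3, lt_div_iff₀ (by positivity)]
    have hP : 0 < Real.cos φ * Real.cos ψ := by positivity
    have hPle : Real.cos φ * Real.cos ψ ≤ Real.cos u ^ 2 := by linarith
    have hk2 : (Real.cosh u) ^ 2 * Real.cos u ^ 2 < 1 := by
      rw [← mul_pow]
      exact pow_lt_one₀ (by have := Real.cosh_pos u; positivity) hk two_ne_zero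
    have hs : 1 - Real.sin φ * Real.sin ψ = 2 - 2 * Real.cos u ^ 2 + Real.cos φ * Real.cos ψ := by
      linarith
    rw [hs]
    have hc1 := Real.one_le_cosh u
    have : (Real.cosh u ^ 2 - 1) * (Real.cos φ * Real.cos ψ)
        ≤ (Real.cosh u ^ 2 - 1) * Real.cos u ^ 2 :=
      mul_le_mul_of_nonneg_left hPle (by nlinarith)
    linarith
  have := Real.cosh_lt_cosh.1 hlt
  rwa [abs_of_pos (by linarith), abs_of_nonneg hd] at this

lemma lint_Ici (h : ℝ) (hh : 0 < h) :
    ∫⁻ y in Ici h, ENNReal.ofReal ((y ^ 2)⁻¹) = ENNReal.ofReal (1 / h) := by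
  rw [setLIntegral_congr (Ioi_ae_eq_Ici (a := h)).symm]
  have hi := integrableOn_Ioi_rpow_of_lt (a := -2) (by norm_num) hh
  have hv := integral_Ioi_rpow_of_lt (a := -2) (by norm_num) hh
  have heq : ∀ y ∈ Ioi h, ENNReal.ofReal ((y ^ 2)⁻¹) = ENNReal.ofReal (y ^ (-2 : ℝ)) := by
    intro y hy
    have hy0 : 0 < y := hh.trans hy
    rw [Real.rpow_neg hy0.le]
    norm_num
  rw [setLIntegral_congr_fun measurableSet_Ioi heq, ← ofReal_integral_eq_lintegral_ofReal hi, hv]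
  · congr 1
    norm_num
    rw [Real.rpow_neg_one]
  · exact ae_restrict_of_forall_mem measurableSet_Ioi fun y hy =>
      Real.rpow_nonneg (hh.trans hy).le _

lemma lint_arcsin (a b c r : ℝ) (hr : 0 < r) (hab : a ≤ b) (ha : c - r < a) (hb : b < c + r) :
    ∫⁻ x in Icc a b, ENNReal.ofReal (1 / √(r ^ 2 - (x - c) ^ 2))
      = ENNReal.ofReal (Real.arcsin ((b - c) / r) - Real.arcsin ((a - c) / r)) := by
  have hpos : ∀ x ∈ Icc a b, 0 < r ^ 2 - (x - c) ^ 2 := by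
    intro x hx
    have : 0 < (r - (x - c)) * (r + (x - c)) :=
      mul_pos (by linarith [hx.2]) (by linarith [hx.1])
    nlinarith
  have hcont : ContinuousOn (fun x => 1 / √(r ^ 2 - (x - c) ^ 2)) (Icc a b) := by
    apply ContinuousOn.div continuousOn_const (by fun_prop)
    intro x hx
    exact (Real.sqrt_pos.2 (hpos x hx)).ne'
  have hd : ∀ x ∈ uIcc a b, HasDerivAt (fun x => Real.arcsin ((x - c) / r))
      (1 / √(r ^ 2 - (x - c) ^ 2)) x := by
    intro x hx
    rw [uIcc_of_le hab] at hx
    have h1 : HasDerivAt (fun x => (x - c) / r) (1 / r) x :=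
      ((hasDerivAt_id x).sub_const c).div_const r
    have hn1 : (x - c) / r ≠ -1 := by
      rw [ne_eq, div_eq_iff hr.ne']; intro h; linarith [hx.1]
    have hn2 : (x - c) / r ≠ 1 := by
      rw [ne_eq, div_eq_iff hr.ne']; intro h; linarith [hx.2]
    have h2 := (Real.hasDerivAt_arcsin hn1 hn2).comp x h1
    convert! h2 using 1
    have : r ^ 2 - (x - c) ^ 2 = r ^ 2 * (1 - ((x - c) / r) ^ 2) := by field_simp
    rw [this, Real.sqrt_mul (by positivity), Real.sqrt_sq hr.le]
    rw [div_mul_div_comm, one_mul, mul_comm]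
  have hI := intervalIntegral.integral_eq_sub_of_hasDerivAt hd
    (ContinuousOn.intervalIntegrable (by rwa [uIcc_of_le hab]))
  rw [← hI, intervalIntegral.integral_of_le hab, ← integral_Icc_eq_integral_Ioc,
    ofReal_integral_eq_lintegral_ofReal (hcont.integrableOn_Icc)]
  exact Filter.Eventually.of_forall fun x => by positivity

lemma area_le (a b c r : ℝ) (hr : 0 < r) (hab : a ≤ b) (ha : c - r < a) (hb : b < c + r)
    (K : Set ℍ) (hK : ∀ z ∈ K, a ≤ z.re ∧ z.re ≤ b ∧ r ^ 2 ≤ (z.re - c) ^ 2 + z.im ^ 2) :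
    hypArea K ≤ ENNReal.ofReal (Real.arcsin ((b - c) / r) - Real.arcsin ((a - c) / r)) := by
  have hpos : ∀ x ∈ Icc a b, 0 < r ^ 2 - (x - c) ^ 2 := by
    intro x hx
    have : 0 < (r - (x - c)) * (r + (x - c)) :=
      mul_pos (by linarith [hx.2]) (by linarith [hx.1])
    nlinarith
  obtain ⟨S, hS⟩ : ∃ S : Set (ℝ × ℝ), S =
    {p | a ≤ p.1 ∧ p.1 ≤ b ∧ √(r ^ 2 - (p.1 - c) ^ 2) ≤ p.2} := ⟨_, rfl⟩
  have hSm : MeasurableSet S := by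
    rw [hS]
    apply IsClosed.measurableSet
    have c1 : Continuous (fun p : ℝ × ℝ => √(r ^ 2 - (p.1 - c) ^ 2)) := by fun_prop
    exact (isClosed_le continuous_const continuous_fst).inter
      ((isClosed_le continuous_fst continuous_const).inter
      (isClosed_le c1 continuous_snd))
  have hsub : ((↑) '' K : Set ℂ) ⊆ Complex.measurableEquivRealProd ⁻¹' S := by
    rintro _ ⟨z, hz, rfl⟩
    obtain ⟨h1, h2, h3⟩ := hK z hz
    rw [hS]
    refine ⟨h1, h2, ?_⟩
    apply Real.sqrt_le_iff.2
    exact ⟨z.im_pos.le, by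
      change r ^ 2 - (z.re - c) ^ 2 ≤ z.im ^ 2
      linarith⟩
  calc hypArea K ≤ ∫⁻ z in Complex.measurableEquivRealProd ⁻¹' S,
        ENNReal.ofReal ((Complex.im z ^ 2)⁻¹) := lintegral_mono_set hsub
    _ = ∫⁻ p in S, ENNReal.ofReal ((p.2 ^ 2)⁻¹) :=
        Complex.volume_preserving_equiv_real_prod.setLIntegral_comp_preimage_emb
          Complex.measurableEquivRealProd.measurableEmbedding
          (fun p : ℝ × ℝ => ENNReal.ofReal ((p.2 ^ 2)⁻¹)) S
    _ = ∫⁻ p, S.indicator (fun p => ENNReal.ofReal ((p.2 ^ 2)⁻¹)) p :=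
        (lintegral_indicator hSm _).symm
    _ = ∫⁻ x, ∫⁻ y, S.indicator (fun p => ENNReal.ofReal ((p.2 ^ 2)⁻¹)) (x, y) := by
        rw [Measure.volume_eq_prod, lintegral_prod]
        exact (Measurable.indicator (by fun_prop) hSm).aemeasurable
    _ = ∫⁻ x, (Icc a b).indicator
          (fun x => ENNReal.ofReal (1 / √(r ^ 2 - (x - c) ^ 2))) x := by
        congr 1
        ext x
        by_cases hx : x ∈ Icc a b
        · rw [indicator_of_mem hx, ← lint_Ici _ (Real.sqrt_pos.2 (hpos x hx)),
            ← lintegral_indicator measurableSet_Ici]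
          congr 1
          ext y
          by_cases hy : √(r ^ 2 - (x - c) ^ 2) ≤ y
          · rw [indicator_of_mem (by rw [hS]; exact ⟨hx.1, hx.2, hy⟩), indicator_of_mem (mem_Ici.2 hy)]
          · rw [indicator_of_notMem (by rw [hS]; exact fun h => hy h.2.2), indicator_of_notMem (fun h => hy (mem_Ici.1 h))]
        · rw [indicator_of_notMem hx]
          have : ∀ y, S.indicator (fun p => ENNReal.ofReal ((p.2 ^ 2)⁻¹)) (x, y) = 0 := by
            intro y
            rw [indicator_of_notMem]
            rw [hS]
            exact fun h => hx ⟨h.1, h.2.1⟩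
          simp [this]
    _ = _ := by
        rw [lintegral_indicator measurableSet_Icc, lint_arcsin a b c r hr hab ha hb]

lemma good_core (A B : ℍ) (h : A.re < B.re) :
    ∃ K : Set ℍ, IsClosed K ∧ MConvex K ∧
      (∀ z : ℍ, z.re = A.re → A.im ≤ z.im → z ∈ K) ∧
      (∀ z : ℍ, z.re = B.re → B.im ≤ z.im → z ∈ K) ∧
      hypArea K < ENNReal.ofReal (dist A B) := by
  have hA := A.im_pos
  have hB := B.im_pos
  have hd : B.re - A.re ≠ 0 := (sub_pos.2 h).ne'
  obtain ⟨c, hc⟩ : ∃ c : ℝ, (A.re - c) ^ 2 + A.im ^ 2 = (B.re - c) ^ 2 + B.im ^ 2 := by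
    refine ⟨(B.re ^ 2 + B.im ^ 2 - A.re ^ 2 - A.im ^ 2) / (2 * (B.re - A.re)), ?_⟩
    field_simp
    ring
  obtain ⟨r, hr0, hr⟩ : ∃ r : ℝ, 0 < r ∧ r ^ 2 = (A.re - c) ^ 2 + A.im ^ 2 :=
    ⟨√((A.re - c) ^ 2 + A.im ^ 2), by positivity, Real.sq_sqrt (by positivity)⟩
  have hAr : |A.re - c| < r := abs_lt_of_sq_lt_sq (by nlinarith) hr0.le
  have hBr : |B.re - c| < r := abs_lt_of_sq_lt_sq (by nlinarith) hr0.le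
  rw [abs_lt] at hAr hBr
  have hK : ∀ z : ℍ, z ∈ (({z : ℍ | 0 ≤ 0 * (z.re ^ 2 + z.im ^ 2) + 1 * z.re + (-A.re)} ∩
    {z : ℍ | 0 ≤ 0 * (z.re ^ 2 + z.im ^ 2) + (-1) * z.re + B.re}) ∩
    {z : ℍ | 0 ≤ 1 * (z.re ^ 2 + z.im ^ 2) + (-2 * c) * z.re + (c ^ 2 - r ^ 2)} : Set ℍ) ↔
      A.re ≤ z.re ∧ z.re ≤ B.re ∧ r ^ 2 ≤ (z.re - c) ^ 2 + z.im ^ 2 := by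
    intro z
    simp only [mem_inter_iff, mem_ofPred_eq]
    constructor
    · rintro ⟨⟨h1, h2⟩, h3⟩
      exact ⟨by linarith, by linarith, by nlinarith⟩
    · rintro ⟨h1, h2, h3⟩
      exact ⟨⟨by linarith, by linarith⟩, by nlinarith⟩
  refine ⟨_, ((closed_half _ _ _).inter (closed_half _ _ _)).inter (closed_half _ _ _),
    ((mconvex_half _ _ _).inter (mconvex_half _ _ _)).inter (mconvex_half _ _ _),
    fun z h1 h2 => (hK z).2 ⟨h1.ge, by linarith, ?_⟩,
    fun z h1 h2 => (hK z).2 ⟨by linarith, h1.le, ?_⟩, ?_⟩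
  · rw [h1]; nlinarith
  · rw [h1]; nlinarith
  refine lt_of_le_of_lt (area_le A.re B.re c r hr0 h.le (by linarith) (by linarith) _
    fun z hz => (hK z).1 hz) ?_
  have lA1 : -1 < (A.re - c) / r := by rw [lt_div_iff₀ hr0]; linarith
  have lA2 : (A.re - c) / r < 1 := by rw [div_lt_iff₀ hr0]; linarith
  have lB1 : -1 < (B.re - c) / r := by rw [lt_div_iff₀ hr0]; linarith
  have lB2 : (B.re - c) / r < 1 := by rw [div_lt_iff₀ hr0]; linarith
  have hne : A ≠ B := by rintro rfl; exact lt_irrefl _ h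
  rw [ENNReal.ofReal_lt_ofReal_iff (dist_pos.2 hne)]
  have cosA : Real.cos (Real.arcsin ((A.re - c) / r)) = A.im / r := by
    rw [Real.cos_arcsin, Real.sqrt_eq_iff_mul_self_eq_of_pos (by positivity)]
    field_simp; linarith
  have cosB : Real.cos (Real.arcsin ((B.re - c) / r)) = B.im / r := by
    rw [Real.cos_arcsin, Real.sqrt_eq_iff_mul_self_eq_of_pos (by positivity)]
    field_simp; linarith
  apply angle_lt _ _ _ (Real.neg_pi_div_two_lt_arcsin.2 lA1)
    (Real.strictMonoOn_arcsin ⟨lA1.le, lA2.le⟩ ⟨lB1.le, lB2.le⟩ (by gcongr))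
    (Real.arcsin_lt_pi_div_two.2 lB2) dist_nonneg
  rw [cosA, cosB, Real.sin_arcsin lA1.le lA2.le, Real.sin_arcsin lB1.le lB2.le,
    UpperHalfPlane.cosh_dist']
  field_simp
  linear_combination -2 * hr - hc

lemma good_vertical (A B C : ℍ) (hAB : A ≠ B) (h1 : A.re = C.re) (h2 : A.im < C.im) :
    GoodTri A B C := by
  rcases lt_trichotomy A.re B.re with h | h | h
  · obtain ⟨K, k1, k2, k3, k4, k5⟩ := good_core A B h
    exact ⟨K, k1, k2, k3 A rfl le_rfl, k4 B rfl le_rfl, k3 C h1.symm h2.le, k5⟩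
  · have hA := A.im_pos
    have hB := B.im_pos
    obtain ⟨r, hr, hrA, hrB⟩ : ∃ r : ℝ, 0 < r ∧ r ≤ A.im ∧ r ≤ B.im :=
      ⟨min A.im B.im, by positivity, min_le_left _ _, min_le_right _ _⟩
    have hK : ∀ z : ℍ, z ∈ (({z : ℍ | 0 ≤ 0 * (z.re ^ 2 + z.im ^ 2) + 1 * z.re + (-A.re)} ∩
      {z : ℍ | 0 ≤ 0 * (z.re ^ 2 + z.im ^ 2) + (-1) * z.re + A.re}) ∩
      {z : ℍ | 0 ≤ 1 * (z.re ^ 2 + z.im ^ 2) + (-2 * A.re) * z.re + (A.re ^ 2 - r ^ 2)} : Set ℍ) ↔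
        A.re ≤ z.re ∧ z.re ≤ A.re ∧ r ^ 2 ≤ (z.re - A.re) ^ 2 + z.im ^ 2 := by
      intro z
      simp only [mem_inter_iff, mem_ofPred_eq]
      constructor
      · rintro ⟨⟨h1, h2⟩, h3⟩
        exact ⟨by linarith, by linarith, by nlinarith⟩
      · rintro ⟨h1, h2, h3⟩
        exact ⟨⟨by linarith, by linarith⟩, by nlinarith⟩
    refine ⟨_, ((closed_half _ _ _).inter (closed_half _ _ _)).inter (closed_half _ _ _),
      ((mconvex_half _ _ _).inter (mconvex_half _ _ _)).inter (mconvex_half _ _ _),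
      (hK A).2 ⟨le_rfl, le_rfl, by nlinarith⟩, (hK B).2 ⟨h.le, h.ge, by nlinarith⟩,
      (hK C).2 ⟨h1.le, h1.ge, by nlinarith⟩, ?_⟩
    refine lt_of_le_of_lt (area_le A.re A.re A.re r hr le_rfl (by linarith) (by linarith) _
      fun z hz => (hK z).1 hz) ?_
    simpa using hAB
  · obtain ⟨K, k1, k2, k3, k4, k5⟩ := good_core B A h
    rw [dist_comm] at k5
    exact ⟨K, k1, k2, k4 A rfl le_rfl, k3 B rfl le_rfl, k4 C h1.symm h2.le, k5⟩

lemma goodTri (A B C : ℍ) (hAB : A ≠ B) (hCA : C ≠ A) : GoodTri A B C := by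
  obtain ⟨g, h1, h2⟩ := exists_vertical A C hCA.symm
  exact GoodTri.of_smul g (good_vertical _ _ _ (fun h => hAB (smul_left_cancel _ h)) h1 h2)

/-- **The area of a hyperbolic triangle is less than the length of any of its edges.**
If `T` is the smallest closed metrically convex subset of `ℍ` containing three pairwise
distinct points `A`, `B`, `C`, then the hyperbolic area of `T` is strictly smaller than
each of the three side lengths. -/
theorem hypArea_triangle_lt_side (A B C : ℍ)
    (hAB : A ≠ B) (hBC : B ≠ C) (hCA : C ≠ A)
    (T : Set ℍ)
    (hT : T = ⋂₀ {K : Set ℍ | IsClosed K ∧ MConvex K ∧ {A, B, C} ⊆ K}) :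
    hypArea T < ENNReal.ofReal (dist A B) ∧
    hypArea T < ENNReal.ofReal (dist B C) ∧
    hypArea T < ENNReal.ofReal (dist C A) := by
  have main : ∀ X Y Z : ℍ, X ≠ Y → Z ≠ X → ({A, B, C} : Set ℍ) ⊆ {X, Y, Z} →
      hypArea T < ENNReal.ofReal (dist X Y) := by
    intro X Y Z hXY hZX hsub
    obtain ⟨K, k1, k2, kX, kY, kZ, k3⟩ := goodTri X Y Z hXY hZX
    refine lt_of_le_of_lt ?_ k3
    rw [hypArea_eq_volume, hypArea_eq_volume]
    apply measure_mono
    rw [hT]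
    apply sInter_subset_of_mem
    refine ⟨k1, k2, hsub.trans ?_⟩
    rintro w (rfl | rfl | rfl) <;> assumption
  refine ⟨main A B C hAB hCA subset_rfl, main B C A hBC hAB ?_, main C A B hCA hBC ?_⟩
  · rintro w (rfl | rfl | rfl) <;> simp
  · rintro w (rfl | rfl | rfl) <;> simp
end

section
/- For every ε > 0 there exists δ > 0 such that for all x, y, p ∈ ℍ with dist(p,x) + dist(p,y) ≤ dist(x,y) + δ, the point p lies within distance ε of the geodesic segment [x,y], i.e. infDist(p, [x,y]) ≤ ε. The choice of δ is uniform: it does not depend on x and y (in particular not on dist(x,y)). -/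
open Metric UpperHalfPlane

/-- The point of the segment in hyperboloid coordinates. -/
lemma exists_comb (x y : ℍ) (α β : ℝ) (hα : 0 ≤ α) (hβ : 0 ≤ β)
    (h : α ^ 2 + β ^ 2 + 2 * α * β * Real.cosh (dist x y) = 1) :
    ∃ z : ℍ, ∀ p : ℍ, Real.cosh (dist p z) =
      α * Real.cosh (dist p x) + β * Real.cosh (dist p y) := by
  have hx := x.im_pos
  have hy := y.im_pos
  have hA : 0 < α / x.im + β / y.im := by
    rcases hα.lt_or_eq with h1 | h1
    · positivity
    · rcases hβ.lt_or_eq with h2 | h2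
      · positivity
      · exfalso
        rw [← h1, ← h2] at h
        norm_num at h
  refine ⟨UpperHalfPlane.mk ⟨(α * x.re / x.im + β * y.re / y.im) / (α / x.im + β / y.im),
    1 / (α / x.im + β / y.im)⟩ (by simpa using hA), fun p => ?_⟩
  have hp := p.im_pos
  rw [cosh_dist'] at h
  rw [cosh_dist', cosh_dist', cosh_dist']
  simp only [UpperHalfPlane.mk_re, UpperHalfPlane.mk_im]
  obtain ⟨a, ha⟩ : ∃ a, a = p.re := ⟨_, rfl⟩
  obtain ⟨b, hb⟩ : ∃ b, b = p.im := ⟨_, rfl⟩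
  obtain ⟨u, hu⟩ : ∃ u, u = x.re := ⟨_, rfl⟩
  obtain ⟨v, hv⟩ : ∃ v, v = x.im := ⟨_, rfl⟩
  obtain ⟨c, hc⟩ : ∃ c, c = y.re := ⟨_, rfl⟩
  obtain ⟨d, hd⟩ : ∃ d, d = y.im := ⟨_, rfl⟩
  simp only [← ha, ← hb, ← hu, ← hv, ← hc, ← hd] at *
  obtain ⟨A, hAe⟩ : ∃ A, A = α / v + β / d := ⟨_, rfl⟩
  obtain ⟨B, hBe⟩ : ∃ B, B = α * u / v + β * c / d := ⟨_, rfl⟩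
  obtain ⟨C, hCe⟩ : ∃ C, C = α * (u^2+v^2) / v + β * (c^2+d^2) / d := ⟨_, rfl⟩
  have hC : A * C = 1 + B ^ 2 := by
    rw [← h, hAe, hBe, hCe]
    field_simp
    ring
  have hR : α * (((a - u) ^ 2 + b ^ 2 + v ^ 2) / (2 * b * v)) +
      β * (((a - c) ^ 2 + b ^ 2 + d ^ 2) / (2 * b * d)) =
      (A * (a^2+b^2) + C - 2 * a * B) / (2 * b) := by
    rw [hAe, hBe, hCe]
    field_simp
    ring
  rw [hR, ← hAe, ← hBe]
  rw [← hAe] at hA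
  have hC' : C = (1 + B^2) / A := by field_simp; linarith
  rw [hC']
  field_simp
  ring

/-- **Uniform thinness of near-minimizers in the hyperbolic plane.**
For every `ε > 0` there is `δ > 0`, independent of the endpoints, such that any point `p`
with `dist p x + dist p y ≤ dist x y + δ` lies within distance `ε` of the geodesic
segment `[x, y]`. -/
theorem near_minimizer_close_to_geodesic :
    ∀ ε > (0 : ℝ), ∃ δ > (0 : ℝ), ∀ x y p : ℍ,
      dist p x + dist p y ≤ dist x y + δ → infDist p (geodSeg x y) ≤ ε := by
  intro ε hε
  have hc : 1 < Real.cosh ε := Real.one_lt_cosh.2 hε.ne'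
  have hl := Real.log_pos hc
  refine ⟨2 * Real.log (Real.cosh ε), by linarith, fun x y p h => ?_⟩
  suffices H : ∃ z ∈ geodSeg x y, dist p z ≤ ε by
    obtain ⟨z, hz, hd⟩ := H
    exact (infDist_le_dist_of_mem hz).trans hd
  rcases eq_or_ne x y with rfl | hxy
  · refine ⟨x, by simp [geodSeg], ?_⟩
    have h2 : Real.log (Real.cosh ε) ≤ ε := by
      rw [Real.log_le_iff_le_exp (by linarith), ← Real.cosh_add_sinh]
      linarith [Real.sinh_pos_iff.2 hε]
    rw [dist_self] at h
    linarith
  have hD : 0 < dist x y := dist_pos.2 hxy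
  obtain ⟨η, hη⟩ : ∃ η, η = (dist p x + dist p y - dist x y) / 2 := ⟨_, rfl⟩
  obtain ⟨s, hs⟩ : ∃ s, s = dist p x - η := ⟨_, rfl⟩
  obtain ⟨t, ht⟩ : ∃ t, t = dist p y - η := ⟨_, rfl⟩
  have e1 : dist x y = s + t := by linarith
  have e2 : dist p x = s + η := by linarith
  have e3 : dist p y = t + η := by linarith
  have t1 := dist_triangle p x y
  have t2 := dist_triangle p y x
  have t3 := dist_triangle x p y
  rw [dist_comm y x] at t2
  rw [dist_comm x p] at t3
  have hs0 : 0 ≤ s := by linarith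
  have ht0 : 0 ≤ t := by linarith
  have hη0 : 0 ≤ η := by linarith
  have hS : 0 < Real.sinh (s + t) := Real.sinh_pos_iff.2 (e1 ▸ hD)
  have hs1 := Real.sinh_nonneg_iff.2 hs0
  have ht1 := Real.sinh_nonneg_iff.2 ht0
  have hη1 := Real.sinh_nonneg_iff.2 hη0
  have qs := Real.cosh_sq s
  have qt := Real.cosh_sq t
  have id1 : Real.sinh t + Real.sinh s * Real.cosh (s + t) =
      Real.cosh s * Real.sinh (s + t) := by
    rw [Real.cosh_add, Real.sinh_add]
    linear_combination (-Real.sinh t) * qs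
  have id2 : Real.sinh s + Real.sinh t * Real.cosh (s + t) =
      Real.cosh t * Real.sinh (s + t) := by
    rw [Real.cosh_add, Real.sinh_add]
    linear_combination (-Real.sinh s) * qt
  obtain ⟨z, hz⟩ := exists_comb x y (Real.sinh t / Real.sinh (s + t))
    (Real.sinh s / Real.sinh (s + t)) (by positivity) (by positivity) (by
      rw [e1]
      field_simp
      have := Real.sinh_add s t
      linear_combination Real.sinh t * id1 + Real.sinh s * id2 - Real.sinh (s+t) * this)
  have zx : dist x z = s := by
    have := hz x
    rw [dist_self, e1, Real.cosh_zero] at this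
    have h2 : Real.cosh (dist x z) = Real.cosh s := by
      rw [this]
      field_simp
      linarith
    have h3 := Real.cosh_le_cosh.1 h2.le
    have h4 := Real.cosh_le_cosh.1 h2.ge
    rw [abs_of_nonneg dist_nonneg, abs_of_nonneg hs0] at h3 h4
    exact le_antisymm h3 h4
  have zy : dist y z = t := by
    have := hz y
    rw [dist_self, dist_comm y x, e1, Real.cosh_zero] at this
    have h2 : Real.cosh (dist y z) = Real.cosh t := by
      rw [this]
      field_simp
      linarith
    have h3 := Real.cosh_le_cosh.1 h2.le
    have h4 := Real.cosh_le_cosh.1 h2.ge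
    rw [abs_of_nonneg dist_nonneg, abs_of_nonneg ht0] at h3 h4
    exact le_antisymm h3 h4
  refine ⟨z, ?_, ?_⟩
  · show dist x z + dist z y = dist x y
    rw [dist_comm z y, zx, zy, e1]
  · have key : Real.cosh (dist p z) ≤ Real.exp η := by
      rw [hz p, e2, e3, ← Real.cosh_add_sinh]
      have : Real.sinh t / Real.sinh (s + t) * Real.cosh (s + η) +
          Real.sinh s / Real.sinh (s + t) * Real.cosh (t + η) =
          Real.cosh η + Real.sinh η * (2 * Real.sinh s * Real.sinh t / Real.sinh (s + t)) := by
        field_simp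
        rw [Real.cosh_add, Real.cosh_add, Real.sinh_add]
        ring
      rw [this]
      have h3 : 2 * Real.sinh s * Real.sinh t / Real.sinh (s + t) ≤ 1 := by
        rw [div_le_one hS, Real.sinh_add]
        nlinarith [Real.sinh_lt_cosh s, Real.sinh_lt_cosh t]
      nlinarith
    have k2 : Real.exp η ≤ Real.cosh ε := by
      rw [← Real.le_log_iff_exp_le (by linarith)]
      linarith
    have k3 := key.trans k2
    rw [Real.cosh_le_cosh, abs_of_nonneg dist_nonneg, abs_of_pos hε] at k3
    exact k3
end

section
/- Let E be a proper metric space, let S be a compact topological space, and let φ_n, φ : S → E be continuous maps such that φ_n converges to φ uniformly on S. For a continuous map ψ : S → E and x, y ∈ S, define d_ψ(x,y) ∈ [0, ∞] as the infimum of the lengths (total variations) of all continuous paths γ : [0,1] → E with γ(0) = ψ(x), γ(1) = ψ(y) and γ([0,1]) ⊆ ψ(S). Then for all x, y ∈ S: limsup_{n→∞} d_{φ_n}(x,y) ≥ d_φ(x,y). -/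
open Filter Set

/-- The intrinsic (length) distance induced by a continuous map `ψ : S → E`:
the infimum of the lengths (total variations) of continuous paths in `E` joining
`ψ x` to `ψ y` whose image is contained in the image of `ψ`. -/
noncomputable def intrinsicDist {E S : Type*} [MetricSpace E] (ψ : S → E)
    (x y : S) : ENNReal :=
  ⨅ (γ : ℝ → E) (_ : ContinuousOn γ (Icc 0 1)) (_ : γ 0 = ψ x) (_ : γ 1 = ψ y)
    (_ : γ '' Icc 0 1 ⊆ range ψ), eVariationOn γ (Icc 0 1)

open Topology in
theorem aux_reparam {E : Type*} [MetricSpace E] (γ : ℝ → E) (hγ : ContinuousOn γ (Icc 0 1))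
    (c : NNReal) (hc : eVariationOn γ (Icc 0 1) ≤ c) :
    ∃ τ : ℝ → ℝ, (∀ s ∈ Icc (0:ℝ) 1, τ s ∈ Icc (0:ℝ) 1) ∧
      γ (τ 0) = γ 0 ∧ γ (τ 1) = γ 1 ∧
      ∀ s ∈ Icc (0:ℝ) 1, ∀ t ∈ Icc (0:ℝ) 1, dist (γ (τ s)) (γ (τ t)) ≤ c * dist s t := by
  set I : Set ℝ := Icc 0 1 with hI
  have h0 : (0:ℝ) ∈ I := by simp [hI]
  have h1 : (1:ℝ) ∈ I := by simp [hI]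
  have hb : BoundedVariationOn γ I := ne_top_of_le_ne_top ENNReal.coe_ne_top hc
  have hl : LocallyBoundedVariationOn γ I := hb.locallyBoundedVariationOn
  set V : ℝ → ℝ := variationOnFromTo γ I 0 with hV
  have hfin : ∀ a b : ℝ, eVariationOn γ (I ∩ Icc a b) ≠ ⊤ := fun a b =>
    ne_top_of_le_ne_top hb (eVariationOn.mono _ inter_subset_left)
  have hsub : ∀ a ∈ I, ∀ b ∈ I, a ≤ b → V b - V a = (eVariationOn γ (I ∩ Icc a b)).toReal := by
    intro a ha b hb' hab
    have := variationOnFromTo.add hl h0 ha hb'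
    rw [variationOnFromTo.eq_of_le γ I hab] at this
    simp only [hV]; linarith
  have hdist : ∀ a ∈ I, ∀ b ∈ I, dist (γ a) (γ b) ≤ |V a - V b| := by
    have key : ∀ a ∈ I, ∀ b ∈ I, a ≤ b → dist (γ a) (γ b) ≤ |V a - V b| := by
      intro a ha b hb' hab
      rw [abs_sub_comm, hsub a ha b hb' hab, abs_of_nonneg ENNReal.toReal_nonneg, dist_edist]
      exact ENNReal.toReal_mono (hfin _ _)
        (eVariationOn.edist_le γ ⟨ha, by simp [hab]⟩ ⟨hb', by simp [hab]⟩)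
    intro a ha b hb'
    rcases le_total a b with h | h
    · exact key a ha b hb' h
    · rw [dist_comm, abs_sub_comm]; exact key b hb' a ha h
  have hcont : ContinuousOn V I := by
    intro x hx
    have l1 := hb.tendsto_eVariationOn_Icc_zero_left ((hγ x hx).mono inter_subset_left)
    have l2 := hb.tendsto_eVariationOn_Icc_zero_right x ((hγ x hx).mono inter_subset_left)
    have l1' := (ENNReal.tendsto_toReal ENNReal.zero_ne_top).comp l1
    have l2' := (ENNReal.tendsto_toReal ENNReal.zero_ne_top).comp l2
    have l3 := l1'.add l2'
    simp only [ENNReal.toReal_zero, add_zero] at l3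
    rw [ContinuousWithinAt, tendsto_iff_dist_tendsto_zero]
    refine squeeze_zero' (Eventually.of_forall fun _ => dist_nonneg) ?_ l3
    filter_upwards [self_mem_nhdsWithin] with y hy
    simp only [Function.comp]
    have p1 : 0 ≤ (eVariationOn γ (I ∩ Icc y x)).toReal := ENNReal.toReal_nonneg
    have p2 : 0 ≤ (eVariationOn γ (I ∩ Icc x y)).toReal := ENNReal.toReal_nonneg
    rw [Real.dist_eq]
    rcases le_total x y with h | h
    · rw [hsub x hx y hy h, abs_of_nonneg p2]; linarith
    · rw [abs_sub_comm, hsub y hy x hx h, abs_of_nonneg p1]; linarith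
  have hV0 : V 0 = 0 := variationOnFromTo.self γ I 0
  have hV1 : V 1 = (eVariationOn γ I).toReal := by
    have := hsub 0 h0 1 h1 zero_le_one
    rw [hV0, ← hI, inter_self] at this
    linarith
  have hV1n : 0 ≤ V 1 := by rw [hV1]; exact ENNReal.toReal_nonneg
  have hV1c : V 1 ≤ c := by rw [hV1]; exact ENNReal.toReal_le_coe_of_le_coe hc
  have hex : ∀ s ∈ I, ∃ t ∈ I, V t = s * V 1 := by
    intro s hs
    have := intermediate_value_Icc zero_le_one hcont
    obtain ⟨t, ht, h⟩ := this (show s * V 1 ∈ Icc (V 0) (V 1) by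
      rw [hV0]; exact ⟨mul_nonneg hs.1 hV1n, mul_le_of_le_one_left hV1n hs.2⟩)
    exact ⟨t, ht, h⟩
  choose! τ hτ hτV using hex
  refine ⟨τ, hτ, ?_, ?_, ?_⟩
  · have := hdist _ (hτ 0 h0) 0 h0
    rw [hτV 0 h0, hV0] at this
    exact dist_le_zero.1 (by simpa using this)
  · have := hdist _ (hτ 1 h1) 1 h1
    rw [hτV 1 h1] at this
    exact dist_le_zero.1 (by simpa using this)
  · intro s hs t ht
    refine (hdist _ (hτ s hs) _ (hτ t ht)).trans ?_
    rw [hτV s hs, hτV t ht, ← sub_mul, abs_mul, abs_of_nonneg hV1n, mul_comm, Real.dist_eq]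
    gcongr

/-- **Lower semicontinuity of induced intrinsic distances under uniform convergence.**
If continuous maps `φ n : S → E` from a compact space into a proper metric space
converge uniformly to a continuous map `φ`, then for all `x y : S` the limsup of the
intrinsic distances induced by the `φ n` is at least the intrinsic distance
induced by `φ`. -/
theorem intrinsicDist_le_limsup
    {E S : Type*} [MetricSpace E] [ProperSpace E]
    [TopologicalSpace S] [CompactSpace S]
    (φ : ℕ → S → E) (φlim : S → E)
    (hφ : ∀ n, Continuous (φ n)) (hφlim : Continuous φlim)
    (huniform : TendstoUniformly φ φlim atTop) :
    ∀ x y : S, intrinsicDist φlim x y ≤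
      limsup (fun n => intrinsicDist (φ n) x y) atTop := by
  intro x y
  refine le_of_forall_gt fun b hb => ?_
  obtain ⟨c, hc1, hc2⟩ := ENNReal.lt_iff_exists_nnreal_btwn.1 hb
  refine lt_of_le_of_lt ?_ hc2
  have hev := eventually_lt_of_limsup_lt hc1
  have hz : ∀ᶠ n in atTop, ∃ z : ℝ → S, φ n (z 0) = φ n x ∧ φ n (z 1) = φ n y ∧
      ∀ s ∈ Icc (0:ℝ) 1, ∀ t ∈ Icc (0:ℝ) 1, dist (φ n (z s)) (φ n (z t)) ≤ c * dist s t := by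
    filter_upwards [hev] with n hn
    simp only [intrinsicDist, iInf_lt_iff] at hn
    obtain ⟨γ, hγ, g0, g1, gr, hlen⟩ := hn
    obtain ⟨τ, hτ, t0, t1, hτd⟩ := aux_reparam γ hγ c hlen.le
    have hr : ∀ s ∈ Icc (0:ℝ) 1, ∃ z, φ n z = γ (τ s) := fun s hs =>
      gr (mem_image_of_mem _ (hτ s hs))
    have : Nonempty S := ⟨x⟩
    choose! z hz using hr
    refine ⟨z, ?_, ?_, ?_⟩
    · rw [hz 0 (by simp), t0, g0]
    · rw [hz 1 (by simp), t1, g1]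
    · intro s hs t ht
      rw [hz s hs, hz t ht]
      exact hτd s hs t ht
  have : Nonempty S := ⟨x⟩
  obtain ⟨z, hz⟩ := hz.choice
  let U : Ultrafilter ℕ := Ultrafilter.of atTop
  have hU : (U : Filter ℕ) ≤ atTop := Ultrafilter.of_le atTop
  have hlim : ∀ s : ℝ, ∃ w : S, Tendsto (fun n => z n s) U (nhds w) := by
    intro s
    obtain ⟨w, -, hw⟩ := isCompact_univ.ultrafilter_le_nhds (U.map fun n => z n s) (by simp)
    exact ⟨w, hw⟩
  choose w hw using hlim
  have huU : TendstoUniformly φ φlim (U : Filter ℕ) := fun u hu => hU (huniform u hu)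
  have hconv : ∀ s, Tendsto (fun n => φ n (z n s)) U (nhds (φlim (w s))) := fun s =>
    huU.tendsto_comp hφlim.continuousAt (hw s)
  have hpt : ∀ a, Tendsto (fun n => φ n a) U (nhds (φlim a)) := fun a => huU.tendsto_at a
  have hLip : LipschitzOnWith c (fun s => φlim (w s)) (Icc (0:ℝ) 1) := by
    refine LipschitzOnWith.of_dist_le_mul fun s hs t ht => ?_
    refine le_of_tendsto ((hconv s).dist (hconv t)) ?_
    filter_upwards [hU hz] with n hn
    exact hn.2.2 s hs t ht
  have e0 : φlim (w 0) = φlim x :=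
    tendsto_nhds_unique_of_eventuallyEq (hconv 0) (hpt x) (by
      filter_upwards [hU hz] with n hn
      exact hn.1)
  have e1 : φlim (w 1) = φlim y :=
    tendsto_nhds_unique_of_eventuallyEq (hconv 1) (hpt y) (by
      filter_upwards [hU hz] with n hn
      exact hn.2.1)
  have hr : (fun s => φlim (w s)) '' Icc (0:ℝ) 1 ⊆ range φlim := by
    rintro _ ⟨s, -, rfl⟩
    exact ⟨w s, rfl⟩
  have hlen := hLip.comp_eVariationOn_le (mapsTo_id (Icc (0:ℝ) 1))
  rw [eVariationOn_id_Icc] at hlen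
  simp only [Function.comp_id, sub_zero, ENNReal.ofReal_one, mul_one] at hlen
  refine le_trans ?_ hlen
  unfold intrinsicDist
  refine iInf_le_of_le (fun s => φlim (w s)) ?_
  refine iInf_le_of_le hLip.continuousOn ?_
  refine iInf_le_of_le e0 ?_
  refine iInf_le_of_le e1 ?_
  exact iInf_le_of_le hr le_rfl
end
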